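/- Let γ ∈ Γ with (γ,γ) ≠ 0. Then for every β ∈ R, the scalar ⟨β,γ^∨⟩ := 2(γ,γ)⁻¹(β,γ) is an integer and β − ⟨β,γ^∨⟩γ ∈ R. -/

import Mathlib

/-- A finite-dimensional Lie superalgebra `g = g₀ ⊕ g₁`: a Lie algebra `g₀`,
a `g₀`-module `g₁` (action `act`), and a symmetric bracket `br : g₁ × g₁ → g₀`
satisfying invariance and the super Jacobi identity. -/
structure LieSuperData (k g0 g1 : Type*) [Field k] [LieRing g0] [LieAlgebra k g0]
    [AddCommGroup g1] [Module k g1] where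
  act : g0 →ₗ[k] g1 →ₗ[k] g1
  act_lie : ∀ (x y : g0) (u : g1), act ⁅x, y⁆ u = act x (act y u) - act y (act x u)
  br : g1 →ₗ[k] g1 →ₗ[k] g0
  br_symm : ∀ u v : g1, br u v = br v u
  br_invariance : ∀ (x : g0) (u v : g1), ⁅x, br u v⁆ = br (act x u) v + br u (act x v)
  super_jacobi : ∀ u v w : g1, act (br u v) w + act (br v w) u + act (br w u) v = 0

/-- A nondegenerate even supersymmetric invariant bilinear form `B = (B₀, B₁)` on a
Lie superalgebra. -/
structure InvForm {k g0 g1 : Type*} [Field k] [LieRing g0] [LieAlgebra k g0]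
    [AddCommGroup g1] [Module k g1] (D : LieSuperData k g0 g1) where
  B0 : g0 →ₗ[k] g0 →ₗ[k] k
  B1 : g1 →ₗ[k] g1 →ₗ[k] k
  B0_symm : ∀ x y : g0, B0 x y = B0 y x
  B0_invariant : ∀ x y z : g0, B0 ⁅x, y⁆ z = B0 x ⁅y, z⁆
  B1_alt : ∀ u v : g1, B1 u v = - B1 v u
  compat : ∀ (x : g0) (u v : g1), B0 x (D.br u v) = B1 (D.act x u) v
  B0_nondeg : ∀ x : g0, (∀ y : g0, B0 x y = 0) → x = 0
  B1_nondeg : ∀ u : g1, (∀ v : g1, B1 u v = 0) → u = 0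

/-- The weight space `(g₀)_α = {x ∈ g₀ : ⁅H, x⁆ = α(H) x for all H ∈ t}`. -/
def evenSpace {k g0 : Type*} [Field k] [LieRing g0] [LieAlgebra k g0]
    (t : LieSubalgebra k g0) (α : Module.Dual k t) : Submodule k g0 where
  carrier := {x | ∀ H : t, ⁅(H : g0), x⁆ = α H • x}
  add_mem' := by
    intro a b ha hb H
    rw [lie_add, ha H, hb H, smul_add]
  zero_mem' := by
    intro H
    rw [lie_zero, smul_zero]
  smul_mem' := by
    intro c x hx H
    rw [lie_smul, hx H, smul_comm]

/-- The weight space `(g₁)_γ = {u ∈ g₁ : H · u = γ(H) u for all H ∈ t}`. -/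
def oddSpace {k g0 g1 : Type*} [Field k] [LieRing g0] [LieAlgebra k g0]
    [AddCommGroup g1] [Module k g1] (D : LieSuperData k g0 g1)
    (t : LieSubalgebra k g0) (γ : Module.Dual k t) : Submodule k g1 where
  carrier := {u | ∀ H : t, D.act (H : g0) u = γ H • u}
  add_mem' := by
    intro a b ha hb H
    rw [map_add, ha H, hb H, smul_add]
  zero_mem' := by
    intro H
    rw [map_zero, smul_zero]
  smul_mem' := by
    intro c u hu H
    rw [map_smul, hu H, smul_comm]

/-- The induced form on weights: `(θ, η) := B₀(H_θ, H_η)`. -/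
def pairing {k g0 : Type*} [Field k] [LieRing g0] [LieAlgebra k g0]
    {t : LieSubalgebra k g0} (B0 : g0 →ₗ[k] g0 →ₗ[k] k)
    (Hd : Module.Dual k t → t) (θ η : Module.Dual k t) : k :=
  B0 (Hd θ : g0) (Hd η : g0)


open Pointwise

namespace IsSl2Triple

open LieModule

variable {k L M : Type*} [Field k] [LieRing L] [LieAlgebra k L]
  [AddCommGroup M] [Module k M] [LieRingModule L M] [LieModule k L M] {h e f : L}

lemma lie_h_toEnd_e_pow (t : IsSl2Triple h e f) {w : M} {μ : k} (hw : ⁅h, w⁆ = μ • w) (n : ℕ) :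
    ⁅h, (toEnd k L M e ^ n) w⁆ = (μ + 2 * n) • (toEnd k L M e ^ n) w := by
  induction n with
  | zero => simpa using hw
  | succ n ih =>
    rw [pow_succ', Module.End.mul_apply, toEnd_apply_apply, leibniz_lie h, t.lie_h_e_smul k, ih,
      lie_smul, smul_lie, ← add_smul]
    congr 1
    push_cast
    ring

lemma lie_e_toEnd_f_pow_succ (t : IsSl2Triple h e f) {w : M} {μ : k} (hw : ⁅h, w⁆ = μ • w)
    (n : ℕ) :
    ⁅e, (toEnd k L M f ^ (n + 1)) w⁆ =
      (toEnd k L M f ^ (n + 1)) ⁅e, w⁆ + ((n + 1) * (μ - n)) • (toEnd k L M f ^ n) w := by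
  have hf (n : ℕ) : ⁅h, (toEnd k L M f ^ n) w⁆ = (μ - 2 * n) • (toEnd k L M f ^ n) w := by
    have := t.symm.lie_h_toEnd_e_pow (w := w) (μ := -μ) (by rw [neg_lie, hw, neg_smul]) n
    rw [neg_lie, neg_eq_iff_eq_neg, ← neg_smul] at this
    rw [this]
    congr 1
    ring
  induction n with
  | zero => simp [leibniz_lie e, t.lie_e_f, hw, add_comm]
  | succ n ih =>
    rw [pow_succ', Module.End.mul_apply, toEnd_apply_apply, leibniz_lie e, t.lie_e_f, hf, ih,
      lie_add, lie_smul, Module.End.mul_apply, toEnd_apply_apply,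
      ← toEnd_apply_apply k L M f ((toEnd k L M f ^ n) w), ← Module.End.mul_apply, ← pow_succ',
      add_left_comm, ← add_smul]
    congr 2
    push_cast
    ring

variable [CharZero k]

lemma exists_toEnd_e_pow_eq_zero [FiniteDimensional k M] (t : IsSl2Triple h e f) {w : M} {μ : k}
    (hw : ⁅h, w⁆ = μ • w) : ∃ n : ℕ, (toEnd k L M e ^ n) w = 0 := by
  by_contra! hne
  have hinj : Function.Injective fun n : ℕ ↦ μ + 2 * (n : k) := fun a b hab ↦ by simpa using hab
  have hli := Module.End.eigenvectors_linearIndependent' (toEnd k L M h)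
    (fun n : ℕ ↦ μ + 2 * (n : k)) hinj (fun n ↦ (toEnd k L M e ^ n) w) fun n ↦ by
      rw [Module.End.hasEigenvector_iff, Module.End.mem_eigenspace_iff]
      exact ⟨t.lie_h_toEnd_e_pow hw n, hne n⟩
  have := hli.finite
  exact not_finite ℕ

/-- On a vector of weight at least `j` which is killed by a power of `e`, `f ^ j` does not
vanish. -/
lemma eq_zero_of_toEnd_f_pow_eq_zero (t : IsSl2Triple h e f) (n : ℕ) :
    ∀ (w : M) (m j : ℕ), ⁅h, w⁆ = (m : k) • w → j ≤ m → (toEnd k L M e ^ n) w = 0 →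
      (toEnd k L M f ^ j) w = 0 → w = 0 := by
  induction n with
  | zero => intro w m j _ _ hn _; simpa using hn
  | succ n ih =>
    intro w m j hw hj hn hf
    have he : ⁅e, w⁆ = 0 := by
      refine ih ⁅e, w⁆ (m + 2) (j + 1) ?_ (by lia) ?_ ?_
      · simpa using t.lie_h_toEnd_e_pow hw 1
      · simpa [pow_succ] using hn
      · have h1 := t.lie_e_toEnd_f_pow_succ hw j
        rw [hf, smul_zero, add_zero, pow_succ', Module.End.mul_apply, hf, map_zero, lie_zero] at h1
        rw [pow_succ']
        exact h1.symm
    by_contra hne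
    exact (HasPrimitiveVectorWith.mk (t := t) hne hw he).pow_toEnd_f_ne_zero_of_eq_nat rfl hj hf

/-- A weight vector of a finite-dimensional representation of an `sl₂` triple has integral weight,
and the power of `f` or `e` that carries it to the opposite weight does not kill it. -/
lemma exists_nat_toEnd_pow_ne_zero [FiniteDimensional k M] (t : IsSl2Triple h e f) {w : M} {μ : k}
    (hne : w ≠ 0) (hw : ⁅h, w⁆ = μ • w) :
    ∃ n : ℕ, (μ = n ∧ (toEnd k L M f ^ n) w ≠ 0) ∨ (μ = -n ∧ (toEnd k L M e ^ n) w ≠ 0) := by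
  obtain ⟨a, ha, ha'⟩ := Nat.exists_not_and_succ_of_not_zero_of_exists
    (p := fun n ↦ (toEnd k L M e ^ n) w = 0) (by simpa using hne) (t.exists_toEnd_e_pow_eq_zero hw)
  obtain ⟨N, hN⟩ := (HasPrimitiveVectorWith.mk (t := t) ha (t.lie_h_toEnd_e_pow hw a)
    (by simpa [pow_succ'] using ha')).exists_nat
  have hμ : μ = ((N - 2 * a : ℤ) : k) := by push_cast; rw [← hN]; ring
  obtain ⟨n, hn | hn⟩ := (N - 2 * a : ℤ).eq_nat_or_neg
  · rw [hn, Int.cast_natCast] at hμ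
    exact ⟨n, .inl ⟨hμ, fun h0 ↦
      hne (t.eq_zero_of_toEnd_f_pow_eq_zero _ w n n (hμ ▸ hw) le_rfl ha' h0)⟩⟩
  · rw [hn, Int.cast_neg, Int.cast_natCast] at hμ
    have hw' : ⁅-h, w⁆ = (n : k) • w := by rw [neg_lie, hw, hμ, neg_smul, neg_neg]
    obtain ⟨b, hb⟩ := t.symm.exists_toEnd_e_pow_eq_zero hw'
    exact ⟨n, .inr ⟨hμ, fun h0 ↦
      hne (t.symm.eq_zero_of_toEnd_f_pow_eq_zero _ w n n hw' le_rfl hb h0)⟩⟩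

end IsSl2Triple

section WeightSpaces

variable {k g0 g1 : Type*} [Field k] [LieRing g0] [LieAlgebra k g0] [AddCommGroup g1] [Module k g1]

lemma mem_evenSpace {t : LieSubalgebra k g0} {α : Module.Dual k t} {x : g0} :
    x ∈ evenSpace t α ↔ ∀ H : t, ⁅(H : g0), x⁆ = α H • x :=
  Iff.rfl

lemma mem_oddSpace {D : LieSuperData k g0 g1} {t : LieSubalgebra k g0} {γ : Module.Dual k t}
    {u : g1} : u ∈ oddSpace D t γ ↔ ∀ H : t, D.act (H : g0) u = γ H • u :=
  Iff.rfl

lemma lie_mem_evenSpace {t : LieSubalgebra k g0} {α β : Module.Dual k t} {x y : g0}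
    (hx : x ∈ evenSpace t α) (hy : y ∈ evenSpace t β) : ⁅x, y⁆ ∈ evenSpace t (β + α) := by
  rw [mem_evenSpace] at *
  intro H
  rw [leibniz_lie, hx, hy, smul_lie, lie_smul, LinearMap.add_apply, add_smul, add_comm]

lemma act_mem_oddSpace (D : LieSuperData k g0 g1) {t : LieSubalgebra k g0}
    {α β : Module.Dual k t} {x : g0} {u : g1}
    (hx : x ∈ evenSpace t α) (hu : u ∈ oddSpace D t β) : D.act x u ∈ oddSpace D t (β + α) := by
  rw [mem_evenSpace] at hx
  rw [mem_oddSpace] at *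
  intro H
  have h1 := D.act_lie H x u
  rw [hx, hu, map_smul, LinearMap.smul_apply, map_smul, eq_sub_iff_add_eq] at h1
  rw [← h1, LinearMap.add_apply, add_smul, add_comm]

lemma br_mem_evenSpace (D : LieSuperData k g0 g1) {t : LieSubalgebra k g0}
    {β γ : Module.Dual k t} {u v : g1}
    (hu : u ∈ oddSpace D t β) (hv : v ∈ oddSpace D t γ) : D.br u v ∈ evenSpace t (β + γ) := by
  rw [mem_oddSpace] at *
  intro H
  rw [D.br_invariance, hu, hv, map_smul, LinearMap.smul_apply, map_smul, LinearMap.add_apply,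
    add_smul]

lemma pow_apply_mem_of_forall_apply_mem {V A : Type*} [AddCommGroup V] [Module k V]
    [AddCommMonoid A] (S : A → Submodule k V) (T : Module.End k V) (α : A)
    (hT : ∀ β, ∀ v ∈ S β, T v ∈ S (β + α)) {β : A} {v : V} (hv : v ∈ S β) (n : ℕ) :
    (T ^ n) v ∈ S (β + n • α) := by
  induction n with
  | zero => simpa using hv
  | succ n ih =>
    rw [pow_succ', Module.End.mul_apply, succ_nsmul, ← add_assoc]
    exact hT _ _ ih

lemma mem_of_mem_evenSpace_zero {t : LieSubalgebra k g0} (hC : t.IsCartanSubalgebra) {x : g0}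
    (hx : x ∈ evenSpace t 0) : x ∈ t := by
  rw [← hC.self_normalizing, LieSubalgebra.mem_normalizer_iff']
  intro y hy
  have := hx ⟨y, hy⟩
  simp only [LinearMap.zero_apply, zero_smul] at this
  rw [this]
  exact t.zero_mem

/-- The action of the even part of a Lie superalgebra on the odd part, as a Lie ring module. -/
abbrev LieSuperData.lieRingModule (D : LieSuperData k g0 g1) : LieRingModule g0 g1 where
  bracket x u := D.act x u
  add_lie x y u := by simp
  lie_add x u v := by simp
  leibniz_lie x y u := by simp [D.act_lie]

lemma LieSuperData.lieModule (D : LieSuperData k g0 g1) :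
    letI := D.lieRingModule
    LieModule k g0 g1 :=
  letI := D.lieRingModule
  { smul_lie := fun c x u ↦ by simp [Bracket.bracket]
    lie_smul := fun c x u ↦ by simp [Bracket.bracket] }

/-- The form `B₁` pairs the weight spaces of `γ` and `-γ` nondegenerately. -/
lemma InvForm.exists_B1_eq_one {D : LieSuperData k g0 g1} (F : InvForm D)
    {t : LieSubalgebra k g0} {Γ : Set (Module.Dual k t)}
    (hg1 : (⨆ γ ∈ Γ, oddSpace D t γ) = ⊤) {γ : Module.Dual k t} {u : g1}
    (hu : u ∈ oddSpace D t γ) (hne : u ≠ 0) : ∃ v ∈ oddSpace D t (-γ), F.B1 u v = 1 := by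
  obtain ⟨v, hv, hv0⟩ : ∃ v ∈ oddSpace D t (-γ), F.B1 u v ≠ 0 := by
    by_contra! h0
    refine hne (F.B1_nondeg u fun v ↦ ?_)
    suffices ⊤ ≤ LinearMap.ker (F.B1 u) from LinearMap.mem_ker.1 (this Submodule.mem_top)
    rw [← hg1]
    refine iSup₂_le fun δ _ v hv ↦ LinearMap.mem_ker.2 ?_
    by_cases hδ : δ = -γ
    · exact h0 v (hδ ▸ hv)
    · obtain ⟨H, hH⟩ : ∃ H, δ H ≠ -γ H := by
        by_contra! h; exact hδ (LinearMap.ext fun H ↦ by simpa using h H)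
      have h1 := F.compat H u v
      rw [D.br_symm, F.compat, hu H, hv H, map_smul, map_smul, LinearMap.smul_apply,
        LinearMap.smul_apply, F.B1_alt v u, smul_eq_mul, smul_eq_mul] at h1
      have h2 : (δ H + γ H) * F.B1 u v = 0 := by linear_combination -h1
      exact (mul_eq_zero.1 h2).resolve_left fun h ↦ hH (eq_neg_of_add_eq_zero_left h)
  refine ⟨(F.B1 u v)⁻¹ • v, Submodule.smul_mem _ _ hv, ?_⟩
  rw [map_smul, smul_eq_mul, inv_mul_cancel₀ hv0]

/-- The restriction of `B₀` to `t` separates points as soon as every weight is represented. -/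
lemma eq_of_forall_B0_eq [FiniteDimensional k g0] {t : LieSubalgebra k g0}
    (B0 : g0 →ₗ[k] g0 →ₗ[k] k) (Hd : Module.Dual k t → t)
    (hHd : ∀ (θ : Module.Dual k t) (H : t), θ H = B0 (Hd θ : g0) (H : g0)) {x y : t}
    (hxy : ∀ H : t, B0 (x : g0) H = B0 (y : g0) H) : x = y := by
  let b : t →ₗ[k] Module.Dual k t :=
    (B0.compl₁₂ t.toSubmodule.subtype t.toSubmodule.subtype : t →ₗ[k] t →ₗ[k] k)
  have hsurj : Function.Surjective b := fun θ ↦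
    ⟨Hd θ, LinearMap.ext fun H ↦ (hHd θ H).symm⟩
  have hinj : Function.Injective b :=
    (LinearMap.injective_iff_surjective_of_finrank_eq_finrank
      Subspace.dual_finrank_eq.symm).2 hsurj
  exact hinj (LinearMap.ext hxy)

/-- A pair of opposite odd root vectors whose bracket is `H_γ`, for a nonisotropic odd root `γ`,
generates an `sl₂` triple with root `2γ` in the even part. -/
lemma LieSuperData.isSl2Triple_of_br_eq [CharZero k] (D : LieSuperData k g0 g1)
    {t : LieSubalgebra k g0} {γ : Module.Dual k t} {u v : g1} (hu : u ∈ oddSpace D t γ)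
    (hv : v ∈ oddSpace D t (-γ)) {h : t} (huv : D.br u v = h) (hh : γ h ≠ 0) :
    IsSl2Triple (((γ h)⁻¹ • h : t) : g0) (D.br u u) (-((4 * (γ h) ^ 2)⁻¹ • D.br v v)) := by
  have hvv : D.act (D.br v v) u = (2 * γ h) • v := by
    have h1 := D.super_jacobi v v u
    rw [D.br_symm v u, huv, hv h, LinearMap.neg_apply] at h1
    rw [← sub_eq_zero, ← h1]
    module
  have hlie : ⁅D.br v v, D.br u u⁆ = (4 * γ h) • (h : g0) := by
    rw [D.br_invariance, hvv, map_smul, LinearMap.smul_apply, map_smul, D.br_symm v u, huv]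
    module
  have hE := br_mem_evenSpace D hu hu h
  have hF := br_mem_evenSpace D hv hv h
  simp only [LinearMap.add_apply, LinearMap.neg_apply] at hE hF
  rw [SetLike.val_smul]
  refine ⟨?_, ?_, ?_, ?_⟩
  · refine smul_ne_zero (inv_ne_zero hh) fun h0 ↦ hh ?_
    rw [show h = 0 from Subtype.ext h0, map_zero]
  · rw [lie_neg, lie_smul, ← lie_skew, hlie, smul_neg, neg_neg, smul_smul]
    congr 1
    field_simp
  · rw [smul_lie, hE, smul_smul, ← Nat.cast_smul_eq_nsmul k]
    congr 1
    push_cast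
    field_simp
    ring
  · rw [smul_lie, lie_neg, lie_smul, hF, ← Nat.cast_smul_eq_nsmul k]
    match_scalars
    field_simp
    ring

/-- For an `sl₂` triple with root `α`, the weights of a finite-dimensional module are integral on
the coroot and are permuted by the corresponding reflection. -/
lemma IsSl2Triple.exists_int_weightSpace_ne_bot [CharZero k] {V : Type*} [AddCommGroup V]
    [Module k V] [FiniteDimensional k V] [LieRingModule g0 V] [LieModule k g0 V]
    {t : LieSubalgebra k g0} {h : t} {e f : g0} (tr : IsSl2Triple (h : g0) e f)
    {α : Module.Dual k t} (he : e ∈ evenSpace t α) (hf : f ∈ evenSpace t (-α))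
    (S : Module.Dual k t → Submodule k V)
    (hS : ∀ β, ∀ w ∈ S β, ∀ H : t, ⁅(H : g0), w⁆ = β H • w)
    (hlie : ∀ α β, ∀ x ∈ evenSpace t α, ∀ w ∈ S β, ⁅x, w⁆ ∈ S (β + α))
    {β : Module.Dual k t} (hβ : S β ≠ ⊥) :
    ∃ m : ℤ, β h = m ∧ S (β - m • α) ≠ ⊥ := by
  obtain ⟨w, hw, hw0⟩ := Submodule.exists_mem_ne_zero_of_ne_bot hβ
  obtain ⟨n, ⟨hn, hne⟩ | ⟨hn, hne⟩⟩ := tr.exists_nat_toEnd_pow_ne_zero hw0 (hS β w hw h)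
  · refine ⟨n, by simpa using hn, fun h0 ↦ hne ?_⟩
    have := pow_apply_mem_of_forall_apply_mem S (LieModule.toEnd k g0 V f) _
      (fun β w hw ↦ hlie _ β f hf w hw) hw n
    rw [show β + n • -α = β - (n : ℤ) • α by module, h0] at this
    simpa using this
  · refine ⟨-n, by simpa using hn, fun h0 ↦ hne ?_⟩
    have := pow_apply_mem_of_forall_apply_mem S (LieModule.toEnd k g0 V e) _
      (fun β w hw ↦ hlie _ β e he w hw) hw n
    rw [show β + n • α = β - (-n : ℤ) • α by module, h0] at this
    simpa using this

end WeightSpaces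

theorem stmt_9 {k g0 g1 : Type*} [Field k] [IsAlgClosed k] [CharZero k]
    [LieRing g0] [LieAlgebra k g0] [FiniteDimensional k g0]
    [AddCommGroup g1] [Module k g1] [FiniteDimensional k g1]
    (D : LieSuperData k g0 g1)
    (hred : LieAlgebra.radical k g0 = LieAlgebra.center k g0)
    (t : LieSubalgebra k g0) (hC : t.IsCartanSubalgebra)
    (Φ Γ : Set (Module.Dual k t))
    (hΦ : ∀ α : Module.Dual k t, α ∈ Φ ↔ (α ≠ 0 ∧ evenSpace t α ≠ ⊥))
    (hΓ : ∀ γ : Module.Dual k t, γ ∈ Γ ↔ oddSpace D t γ ≠ ⊥)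
    (hΓ0 : (0 : Module.Dual k t) ∉ Γ)
    (hdisj : Φ ∩ Γ = ∅)
    (hg0 : t.toSubmodule ⊔ (⨆ α ∈ Φ, evenSpace t α) = ⊤)
    (hg1 : (⨆ γ ∈ Γ, oddSpace D t γ) = ⊤)
    (F : InvForm D)
    (Hd : Module.Dual k t → t)
    (hHd : ∀ (θ : Module.Dual k t) (H : t), θ H = F.B0 (Hd θ : g0) (H : g0))
    (γ : Module.Dual k t) (hγ : γ ∈ Γ) (hni : pairing F.B0 Hd γ γ ≠ 0) :
    ∀ β ∈ Φ ∪ Γ,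
      (∃ n : ℤ, (n : k) = (2 * (pairing F.B0 Hd γ γ)⁻¹ * pairing F.B0 Hd β γ)) ∧ β - (2 * (pairing F.B0 Hd γ γ)⁻¹ * pairing F.B0 Hd β γ) • γ ∈ Φ ∪ Γ := by
  have hpair (β : Module.Dual k t) : pairing F.B0 Hd β γ = β (Hd γ) := (hHd β (Hd γ)).symm
  rw [hpair] at hni
  simp only [hpair]
  obtain ⟨u, hu, hu0⟩ := Submodule.exists_mem_ne_zero_of_ne_bot ((hΓ γ).1 hγ)
  obtain ⟨v, hv, huv1⟩ := F.exists_B1_eq_one hg1 hu hu0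
  have huv : D.br u v = Hd γ := by
    have hmem : D.br u v ∈ t :=
      mem_of_mem_evenSpace_zero hC (by simpa using br_mem_evenSpace D hu hv)
    suffices (⟨D.br u v, hmem⟩ : t) = Hd γ from congrArg Subtype.val this
    refine eq_of_forall_B0_eq F.B0 Hd hHd fun H ↦ ?_
    rw [F.B0_symm, F.compat, hu H, map_smul, LinearMap.smul_apply, huv1, smul_eq_mul, mul_one, hHd]
  have tr := D.isSl2Triple_of_br_eq hu hv huv hni
  have hE := br_mem_evenSpace D hu hu
  have hF := Submodule.neg_mem _ (Submodule.smul_mem _ (4 * (γ (Hd γ)) ^ 2)⁻¹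
    (br_mem_evenSpace D hv hv))
  rw [← neg_add] at hF
  have hcoroot (β : Module.Dual k t) :
      β ((γ (Hd γ))⁻¹ • Hd γ) = (γ (Hd γ))⁻¹ * β (Hd γ) := map_smul β _ _
  have hreflect (β : Module.Dual k t) (m : ℤ) : β - m • (γ + γ) = β - (2 * (m : k)) • γ := by
    rw [← Int.cast_smul_eq_zsmul k]
    module
  rintro β (hβ | hβ)
  · obtain ⟨hβ0, hβ1⟩ := (hΦ β).1 hβ
    obtain ⟨m, hm, hS⟩ := tr.exists_int_weightSpace_ne_bot hE hF (evenSpace t)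
      (fun _ _ hw ↦ hw) (fun _ _ _ hx _ hw ↦ lie_mem_evenSpace hx hw) hβ1
    rw [hcoroot] at hm
    rw [hreflect] at hS
    rw [mul_assoc, hm]
    refine ⟨⟨2 * m, by push_cast; rfl⟩, .inl ((hΦ _).2 ⟨fun h0 ↦ hβ0 ?_, hS⟩)⟩
    rw [sub_eq_zero] at h0
    have hm0 : (m : k) = 0 := by
      rw [h0, LinearMap.smul_apply, smul_eq_mul, mul_left_comm, inv_mul_cancel₀ hni] at hm
      linear_combination hm
    rw [h0, hm0, mul_zero, zero_smul]
  · let := D.lieRingModule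
    have := D.lieModule
    obtain ⟨m, hm, hS⟩ := tr.exists_int_weightSpace_ne_bot (V := g1) hE hF (oddSpace D t)
      (fun _ _ hw ↦ hw) (fun _ _ _ hx _ hw ↦ act_mem_oddSpace D hx hw) ((hΓ β).1 hβ)
    rw [hcoroot] at hm
    rw [hreflect] at hS
    rw [mul_assoc, hm]
    exact ⟨⟨2 * m, by push_cast; rfl⟩, .inr ((hΓ _).2 hS)⟩
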